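/- Let I_C ⊆ R be a saturated homogeneous ideal of height c, let I_S ⊆ I_C be a homogeneous ideal such that R/I_S is Cohen–Macaulay of height c−1, and let f ∈ R be a homogeneous form of degree d that is a nonzerodivisor on R/I_S. Set I = f·I_C + I_S. Then: (a) R/I is Cohen–Macaulay if and only if R/I_C is Cohen–Macaulay; and (b) the multiplicity satisfies e(R/I) = e(R/I_C) + d·e(R/I_S). -/

import Mathlib

/- ------------------------------------------------------------------
   Common definitions
------------------------------------------------------------------ -/

open MvPolynomial CategoryTheory

noncomputable section

/-- The height of an ideal: the infimum of the heights of the prime ideals containing it. -/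
noncomputable def idealHeight {A : Type*} [CommRing A] (I : Ideal A) : ℕ∞ :=
  ⨅ P ∈ {P : PrimeSpectrum A | I ≤ P.asIdeal}, Order.height P

/-- The depth of a module `M` with respect to an ideal `J`: the supremum of the lengths of
`M`-regular sequences consisting of elements of `J`. -/
noncomputable def idealDepth {A : Type*} [CommRing A] (J : Ideal A)
    (M : Type*) [AddCommGroup M] [Module A M] : ℕ∞ :=
  sSup {n : ℕ∞ | ∃ rs : List A, (rs.length : ℕ∞) = n ∧ (∀ r ∈ rs, r ∈ J) ∧
    RingTheory.Sequence.IsRegular M rs}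

/-- The irrelevant maximal ideal `(x_i : i ∈ σ)` of the polynomial ring `k[x_i : i ∈ σ]`. -/
def irrelevantIdeal (k : Type) [Field k] (σ : Type) : Ideal (MvPolynomial σ k) :=
  Ideal.span (Set.range (X : σ → MvPolynomial σ k))

/-- The quotient of a polynomial ring by an ideal `I` is Cohen–Macaulay if its depth with
respect to the irrelevant maximal ideal equals its Krull dimension. -/
def IsCMQuotient {k : Type} [Field k] {σ : Type} (I : Ideal (MvPolynomial σ k)) : Prop :=
  (idealDepth (irrelevantIdeal k σ) (MvPolynomial σ k ⧸ I) : WithBot ℕ∞)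
    = ringKrullDim (MvPolynomial σ k ⧸ I)

/-- An ideal of a polynomial ring is homogeneous if it contains all homogeneous components
of each of its elements. -/
def IsHomogeneousIdeal {k : Type} [Field k] {σ : Type} (I : Ideal (MvPolynomial σ k)) : Prop :=
  ∀ p ∈ I, ∀ i : ℕ, homogeneousComponent i p ∈ I

/-- The Hilbert function of `R/I`, `t ↦ dim_k [R/I]_t`, as a function `ℤ → ℤ`
(equal to `0` in negative degrees). -/
noncomputable def hilbertFn (k : Type) [Field k] {σ : Type} (I : Ideal (MvPolynomial σ k))
    (t : ℤ) : ℤ :=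
  if t < 0 then 0
  else
    (Module.finrank k (homogeneousSubmodule σ k t.toNat) : ℤ) -
    (Module.finrank k
      ((Submodule.restrictScalars k (I : Submodule (MvPolynomial σ k) (MvPolynomial σ k))) ⊓
        homogeneousSubmodule σ k t.toNat : Submodule k (MvPolynomial σ k)) : ℤ)

/-- `P` is the Hilbert polynomial of `R/I` if it agrees with the Hilbert function of `R/I`
in all sufficiently large degrees. -/
def IsHilbertPolyOf (k : Type) [Field k] {σ : Type} (I : Ideal (MvPolynomial σ k))
    (P : Polynomial ℚ) : Prop :=
  ∃ N : ℤ, ∀ t : ℤ, N ≤ t → (hilbertFn k I t : ℚ) = P.eval (t : ℚ)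

open Classical in
/-- The Hilbert polynomial of `R/I` (defined as `0` if none exists). -/
noncomputable def hilbertPoly (k : Type) [Field k] {σ : Type} (I : Ideal (MvPolynomial σ k)) :
    Polynomial ℚ :=
  if h : ∃ P : Polynomial ℚ, IsHilbertPolyOf k I P then h.choose else 0

/-- The multiplicity (degree) `e(R/I)`: `(δ-1)!` times the leading coefficient of the Hilbert
polynomial of `R/I`, whose degree is `δ - 1` where `δ = dim R/I ≥ 1`. -/
noncomputable def multiplicityDeg (k : Type) [Field k] {σ : Type}
    (I : Ideal (MvPolynomial σ k)) : ℚ :=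
  (Nat.factorial (hilbertPoly k I).natDegree) * (hilbertPoly k I).leadingCoeff

/-- The `m`-th symbolic power of an ideal `J`:
`J^{(m)} = ⋂_{P ∈ Ass(A/J)} (J^m A_P ∩ A)`. -/
noncomputable def symbolicPower {A : Type*} [CommRing A] (J : Ideal A) (m : ℕ) : Ideal A :=
  sInf { K : Ideal A | ∃ (P : Ideal A) (hP : IsAssociatedPrime P (A ⧸ J)),
    K = Ideal.comap (algebraMap A (Localization (@Ideal.primeCompl A _ P hP.1)))
          (Ideal.map (algebraMap A (Localization (@Ideal.primeCompl A _ P hP.1))) (J ^ m)) }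

/-- `α(I)`: the least degree of a nonzero form in `I`. -/
noncomputable def alphaDeg (k : Type) [Field k] {σ : Type} (I : Ideal (MvPolynomial σ k)) : ℕ :=
  sInf {d : ℕ | ∃ p ∈ I, p ≠ 0 ∧ MvPolynomial.IsHomogeneous p d}

/-- `dim_k Tor_i^A(M, N)`, the rank over the base field `k` of the Tor module. -/
noncomputable def torRank (k : Type) [Field k] (A : Type) [CommRing A] [Algebra k A]
    (M N : Type) [AddCommGroup M] [Module A M] [AddCommGroup N] [Module A N] (i : ℕ) :
    Cardinal :=
  Module.rank k (RestrictScalars k A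
    (((Tor (ModuleCat A) i).obj (ModuleCat.of A M)).obj (ModuleCat.of A N)))

/-- The `i`-th total Betti number `dim_k Tor_i(S/I, k)` of `S/I`, where
`k = S/(x_i : i ∈ σ)`. -/
noncomputable def bettiNum (k : Type) [Field k] {σ : Type} (I : Ideal (MvPolynomial σ k))
    (i : ℕ) : Cardinal :=
  torRank k (MvPolynomial σ k) (MvPolynomial σ k ⧸ I)
    (MvPolynomial σ k ⧸ irrelevantIdeal k σ) i

/-- The first map `I_S → I_C ⊕ I_S`, `g ↦ (g, f·g)`, of the basic double linkage sequence. -/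
def bdlFirstMap {A : Type*} [CommRing A] {I_S I_C : Ideal A} (h : I_S ≤ I_C) (f : A) :
    I_S →ₗ[A] I_C × I_S :=
  LinearMap.prod (Submodule.inclusion h) (f • LinearMap.id)

/-- The second map `I_C ⊕ I_S → f·I_C + I_S`, `(a, b) ↦ f·a - b`, of the basic double
linkage sequence. -/
def bdlSecondMap {A : Type*} [CommRing A] (I_C I_S : Ideal A) (f : A) :
    I_C × I_S →ₗ[A] ↥(Ideal.span {f} * I_C + I_S) :=
  LinearMap.coprod
    (LinearMap.codRestrict ((Ideal.span {f} * I_C + I_S : Ideal A) : Submodule A A)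
      (f • (Submodule.subtype (I_C : Submodule A A)))
      (fun c => Submodule.mem_sup_left
        (Ideal.mul_mem_mul (Ideal.mem_span_singleton_self f) c.2)))
    (- LinearMap.codRestrict ((Ideal.span {f} * I_C + I_S : Ideal A) : Submodule A A)
      (Submodule.subtype (I_S : Submodule A A))
      (fun c => Submodule.mem_sup_right c.2))

/-- The ideal `I_{V_{λ,c}}` of the codimension-`c` configuration determined by `f_1, …, f_s`:
the intersection of the ideals `(f_{i_1}, …, f_{i_c})` over all `c`-subsets. -/
def configIdeal {A : Type*} [CommRing A] {s : ℕ} (c : ℕ) (f : Fin s → A) : Ideal A :=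
  ⨅ T ∈ {T : Finset (Fin s) | T.card = c}, Ideal.span (f '' ↑T)

/-- Every sublist of at most `m` of the elements `f 1, …, f s` (in any order, without
repetitions) is a regular sequence. -/
def SubsetsRegular {A : Type*} [CommRing A] {s : ℕ} (f : Fin s → A) (m : ℕ) : Prop :=
  ∀ l : List (Fin s), l.Nodup → l.length ≤ m →
    RingTheory.Sequence.IsRegular A (l.map f)

/-- `Δ` is (the independence complex of) a matroid on `{1, …, s}`: a nonempty collection of
subsets closed under inclusion and satisfying the augmentation axiom. -/
def IsMatroid {s : ℕ} (Δ : Finset (Fin s) → Prop) : Prop :=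
  Δ ∅ ∧ (∀ F G : Finset (Fin s), Δ F → G ⊆ F → Δ G) ∧
    (∀ F G : Finset (Fin s), Δ F → Δ G → G.card < F.card →
      ∃ j ∈ F, j ∉ G ∧ Δ (insert j G))

/-- `F` is a basis (facet) of the simplicial complex `Δ`: a maximal face. -/
def IsBasisOf {s : ℕ} (Δ : Finset (Fin s) → Prop) (F : Finset (Fin s)) : Prop :=
  Δ F ∧ ∀ G : Finset (Fin s), Δ G → F ⊆ G → G = F

/-- The Stanley–Reisner ideal of `Δ`, generated by the squarefree monomials corresponding
to the non-faces of `Δ`. -/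
def stanleyReisnerIdeal (k : Type) [Field k] {s : ℕ} (Δ : Finset (Fin s) → Prop) :
    Ideal (MvPolynomial (Fin s) k) :=
  Ideal.span
    ((fun F : Finset (Fin s) => ∏ i ∈ F, (X i : MvPolynomial (Fin s) k)) '' {F | ¬ Δ F})

/-- The ideal `I_{W_c}`: the intersection of all ideals `(A_{i_1,j_1}, …, A_{i_c,j_c})`
where `i_1 < ⋯ < i_c` and each generator is chosen from a different group. -/
def multiPartiteIdeal {A : Type*} [CommRing A] {s : ℕ} (c : ℕ) {e : Fin s → ℕ}
    (g : (i : Fin s) → Fin (e i) → A) : Ideal A :=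
  ⨅ T ∈ {T : Finset (Fin s) | T.card = c}, ⨅ j : (i : Fin s) → Fin (e i),
    Ideal.span ((fun i => g i (j i)) '' ↑T)

end

theorem ringKrullDim_le_of_isIntegral (B A : Type*) [CommRing B] [CommRing A] [Algebra B A]
    [Algebra.IsIntegral B A] : ringKrullDim A ≤ ringKrullDim B := by
  refine Order.krullDim_le_of_strictMono (PrimeSpectrum.comap (algebraMap B A)) ?_
  intro P Q h
  have h' : P.asIdeal < Q.asIdeal := h
  exact Ideal.IsIntegral.comap_lt_comap (R := B) h'

theorem ringKrullDim_le_of_isIntegral_of_injective (B A : Type*) [CommRing B] [CommRing A]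
    [Algebra B A] [Algebra.IsIntegral B A] (h : Function.Injective (algebraMap B A)) :
    ringKrullDim B ≤ ringKrullDim A := by
  refine iSup_le fun l ↦ ?_
  obtain ⟨P, -, hP, hPl⟩ := Ideal.exists_ideal_over_prime_of_isIntegral
    l.head.asIdeal (⊥ : Ideal A)
    ((RingHom.ker_eq_comap_bot _).symm.trans_le
      ((RingHom.injective_iff_ker_eq_bot _).1 h ▸ bot_le))
  have : P.LiesOver l.head.asIdeal := ⟨hPl.symm⟩
  obtain ⟨L, hL, -⟩ := Ideal.exists_ltSeries_of_hasGoingUp l P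
  rw [← hL]
  exact Order.LTSeries.length_le_krullDim L

theorem ringKrullDim_quotient_under_le (B : Type*) {A : Type*} [CommRing B] [CommRing A]
    [Algebra B A] [Algebra.IsIntegral B A] (Q : Ideal A) :
    ringKrullDim (B ⧸ Q.under B) ≤ ringKrullDim (A ⧸ Q) :=
  ringKrullDim_le_of_isIntegral_of_injective _ _ Ideal.algebraMap_quotient_injective

theorem MvPolynomial.height_of_isMaximal {k : Type*} [Field k] (s : ℕ)
    (M : Ideal (MvPolynomial (Fin s) k)) [hM : M.IsMaximal] : M.height = s := by
  induction s with
  | zero =>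
    have := M.height_le_ringKrullDim_of_isPrime
    rw [MvPolynomial.ringKrullDim_of_isNoetherianRing, ringKrullDim_eq_zero_of_field] at this
    simpa using this
  | succ s ih =>
    let e := (finSuccEquiv k s).toRingEquiv
    let P : Ideal (Polynomial (MvPolynomial (Fin s) k)) := M.map e
    have hP : P.IsMaximal := Ideal.map_isMaximal_of_equiv e
    have h1 : P.height = M.height := e.height_map M
    have hp : (P.comap Polynomial.C).IsMaximal :=
      Polynomial.isMaximal_comap_C_of_isJacobsonRing P
    have : P.LiesOver (P.comap Polynomial.C) := ⟨rfl⟩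
    rw [← h1, Polynomial.height_eq_height_add_one (P.comap Polynomial.C) P, ih]
    simp

/-- In an affine domain every maximal ideal has height equal to the dimension. -/
theorem Ideal.IsMaximal.height_eq_ringKrullDim_of_finiteType {k A : Type*} [Field k] [CommRing A]
    [IsDomain A] [Algebra k A] [Algebra.FiniteType k A] (M : Ideal A) [hM : M.IsMaximal] :
    (M.height : WithBot ℕ∞) = ringKrullDim A := by
  refine le_antisymm M.height_le_ringKrullDim_of_isPrime ?_
  obtain ⟨t, g, hg, hintegral⟩ := exists_integral_inj_algHom_of_fg k A
  let := g.toAlgebra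
  have hA : Algebra.IsIntegral (MvPolynomial (Fin t) k) A := ⟨hintegral⟩
  have : FaithfulSMul (MvPolynomial (Fin t) k) A := (faithfulSMul_iff_algebraMap_injective _ _).2 hg
  have : IsNoetherianRing A := Algebra.FiniteType.isNoetherianRing k A
  have h1 := Ideal.height_eq_height_add_of_liesOver_of_hasGoingDown
    (M.under (MvPolynomial (Fin t) k)) M
  have h2 : (M.under (MvPolynomial (Fin t) k)).IsMaximal :=
    Ideal.isMaximal_comap_of_isIntegral_of_isMaximal M
  rw [MvPolynomial.height_of_isMaximal] at h1
  calc ringKrullDim A ≤ ringKrullDim (MvPolynomial (Fin t) k) := ringKrullDim_le_of_isIntegral _ _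
    _ = t := by simp [MvPolynomial.ringKrullDim_of_isNoetherianRing]
    _ ≤ _ := by rw [h1]; exact_mod_cast le_self_add

theorem Ideal.height_add_ringKrullDim_quotient_le {A : Type*} [CommRing A] (P : Ideal A)
    [hP : P.IsPrime] : (P.height : WithBot ℕ∞) + ringKrullDim (A ⧸ P) ≤ ringKrullDim A := by
  have : Nonempty (PrimeSpectrum A) := ⟨⟨P, hP⟩⟩
  have h1 : PrimeSpectrum.zeroLocus (P : Set A) = Set.Ici (⟨P, hP⟩ : PrimeSpectrum A) := rfl
  have h3 : ringKrullDim A = ((⨆ a : PrimeSpectrum A, Order.height a + Order.coheight a : ℕ∞) :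
      WithBot ℕ∞) := Order.krullDim_eq_iSup_height_add_coheight_of_nonempty
  rw [h3, ringKrullDim_quotient, h1, ← Order.coheight_eq_krullDim_Ici]
  have h2 : P.height = Order.height (⟨P, hP⟩ : PrimeSpectrum A) :=
    PrimeSpectrum.height_eq_orderHeight ⟨P, hP⟩
  rw [h2]
  exact_mod_cast le_iSup (fun a : PrimeSpectrum A ↦ Order.height a + Order.coheight a) ⟨P, hP⟩

theorem Ideal.height_add_one_le_height_comap_mk {A : Type*} [CommRing A] [IsDomain A]
    [IsNoetherianRing A] (I : Ideal A) (hI : I ≠ ⊥) (Q : Ideal (A ⧸ I)) [hQ : Q.IsPrime] :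
    Q.height + 1 ≤ (Q.comap (Ideal.Quotient.mk I)).height := by
  have h2 : (Q.comap (Ideal.Quotient.mk I)).height =
      Order.height (PrimeSpectrum.comap (Ideal.Quotient.mk I) ⟨Q, hQ⟩) :=
    PrimeSpectrum.height_eq_orderHeight (PrimeSpectrum.comap (Ideal.Quotient.mk I) ⟨Q, hQ⟩)
  obtain ⟨l, hl, hlen⟩ := Q.exists_ltSeries_length_eq_height
  let l' : LTSeries (PrimeSpectrum A) := l.map (PrimeSpectrum.comap (Ideal.Quotient.mk I))
    (RingHom.strictMono_comap_of_surjective Ideal.Quotient.mk_surjective)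
  have hlt : (⊥ : PrimeSpectrum A) < l'.head := by
    rw [bot_lt_iff_ne_bot]
    intro h
    apply hI
    rw [eq_bot_iff]
    have h3 : l'.head.asIdeal = ⊥ := by rw [h]; rfl
    rw [← h3, LTSeries.head_map]
    intro x hx
    simp [Ideal.Quotient.eq_zero_iff_mem.2 hx]
  have := Order.length_le_height (p := l'.cons ⊥ hlt)
    (x := PrimeSpectrum.comap (Ideal.Quotient.mk I) ⟨Q, hQ⟩) (by
      rw [RelSeries.last_cons, LTSeries.last_map, hl])
  rw [h2, ← hlen]
  simpa [l'] using this

theorem MvPolynomial.height_add_ringKrullDim_quotient_of_isPrime {k : Type*} [Field k] (s : ℕ)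
    (P : Ideal (MvPolynomial (Fin s) k)) [hP : P.IsPrime] :
    (P.height : WithBot ℕ∞) + ringKrullDim (MvPolynomial (Fin s) k ⧸ P) = s := by
  induction s using Nat.strong_induction_on with
  | _ s ih =>
  have hR : ringKrullDim (MvPolynomial (Fin s) k) = s := by
    simp [MvPolynomial.ringKrullDim_of_isNoetherianRing]
  refine le_antisymm (hR ▸ P.height_add_ringKrullDim_quotient_le) ?_
  by_cases hb : P = ⊥
  · subst hb
    rw [Ideal.height_bot, ringKrullDim_eq_of_ringEquiv (RingEquiv.quotientBot _), hR]
    simp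
  obtain ⟨f, hfP, hf⟩ := hP.exists_mem_prime_of_ne_bot hb
  let J := Ideal.span {f}
  have hJP : J ≤ P := by rwa [Ideal.span_singleton_le_iff_mem]
  have hJ : J.IsPrime := (Ideal.span_singleton_prime hf.ne_zero).2 hf
  have hJb : J ≠ ⊥ := by simpa [J] using hf.ne_zero
  let A := MvPolynomial (Fin s) k ⧸ J
  obtain ⟨t, g, hg, hintegral⟩ := exists_integral_inj_algHom_of_fg k A
  let := g.toAlgebra
  let B := MvPolynomial (Fin t) k
  have hA : Algebra.IsIntegral B A := ⟨hintegral⟩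
  have : FaithfulSMul B A := (faithfulSMul_iff_algebraMap_injective _ _).2 hg
  have hB : ringKrullDim B = t := by
    simp [B, MvPolynomial.ringKrullDim_of_isNoetherianRing]
  have hAt : ringKrullDim A = t := hB ▸ le_antisymm (ringKrullDim_le_of_isIntegral _ _)
    (ringKrullDim_le_of_isIntegral_of_injective B A hg)
  have hts : t + 1 = s := by
    obtain ⟨M, hM, hPM⟩ := P.exists_le_maximal hP.ne_top
    have := Module.ringKrullDim_quotient_add_one_of_mem_nonZeroDivisors
      (mem_nonZeroDivisors_of_ne_zero hf.ne_zero) (p := M) (by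
        rw [hR, MvPolynomial.height_of_isMaximal]; rfl) (hPM hfP)
    rw [hR] at this
    change ringKrullDim A + 1 = _ at this
    rw [hAt] at this
    exact_mod_cast this
  let Q : Ideal A := P.map (Ideal.Quotient.mk J)
  have hQ : Q.IsPrime := Ideal.isPrime_map_quotientMk_of_isPrime hJP
  have hQP : Q.comap (Ideal.Quotient.mk J) = P := by
    simp [Q, Ideal.comap_map_of_surjective _ Ideal.Quotient.mk_surjective, 
      ← RingHom.ker_eq_comap_bot, hJP]
  have h1 : Q.height + 1 ≤ P.height := hQP ▸ Ideal.height_add_one_le_height_comap_mk J hJb Q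
  let q := Q.under B
  have h2 : q.height ≤ Q.height := by
    rw [Ideal.height_eq_height_add_of_liesOver_of_hasGoingDown q Q]
    exact le_self_add
  have h3 : ringKrullDim (B ⧸ q) ≤ ringKrullDim (A ⧸ Q) :=
    ringKrullDim_quotient_under_le B Q
  have h4 : ringKrullDim (A ⧸ Q) = ringKrullDim (MvPolynomial (Fin s) k ⧸ P) :=
    ringKrullDim_eq_of_ringEquiv (DoubleQuot.quotQuotEquivQuotOfLE hJP)
  have h5 := ih t (by omega) q
  rw [← h4]
  calc (s : WithBot ℕ∞) = ((t + 1 : ℕ) : WithBot ℕ∞) := by rw [hts]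
    _ = (q.height + ringKrullDim (B ⧸ q)) + 1 := by rw [h5]; rfl
    _ = ((q.height + 1 : ℕ∞) : WithBot ℕ∞) + ringKrullDim (B ⧸ q) := by
      rw [add_right_comm]; rfl
    _ ≤ _ := add_le_add (WithBot.coe_le_coe.2 ((add_le_add_left h2 1).trans h1)) h3

theorem LTSeries.length_le_ringKrullDim_quotient {A : Type*} [CommRing A] {I J : Ideal A}
    (l : LTSeries (PrimeSpectrum.zeroLocus (I : Set A))) (h : J ≤ l.head.1.asIdeal) :
    (l.length : WithBot ℕ∞) ≤ ringKrullDim (A ⧸ J) := by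
  rw [ringKrullDim_quotient]
  let l' : LTSeries (PrimeSpectrum.zeroLocus (J : Set A)) :=
    ⟨l.length, fun i ↦ ⟨(l i).1, h.trans (LTSeries.head_le l i)⟩, fun i ↦ l.step i⟩
  exact Order.LTSeries.length_le_krullDim l'

theorem MvPolynomial.height_add_ringKrullDim_quotient {k : Type*} [Field k] (s : ℕ)
    (J : Ideal (MvPolynomial (Fin s) k)) (hJ : J ≠ ⊤) :
    (J.height : WithBot ℕ∞) + ringKrullDim (MvPolynomial (Fin s) k ⧸ J) = s := by
  obtain ⟨c, hc⟩ := ENat.ne_top_iff_exists.1 (Ideal.height_ne_top hJ)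
  refine le_antisymm ?_ ?_
  · rw [ringKrullDim_quotient, Order.krullDim]
    have : Nonempty (PrimeSpectrum.zeroLocus (J : Set (MvPolynomial (Fin s) k))) := by
      obtain ⟨M, hM, hJM⟩ := J.exists_le_maximal hJ
      exact ⟨⟨⟨M, hM.isPrime⟩, hJM⟩⟩
    have key : ∀ l : LTSeries (PrimeSpectrum.zeroLocus (J : Set (MvPolynomial (Fin s) k))),
        c + l.length ≤ s := by
      intro l
      have h1 := MvPolynomial.height_add_ringKrullDim_quotient_of_isPrime s l.head.1.asIdeal
      have h2 : J.height ≤ l.head.1.asIdeal.height := Ideal.height_mono l.head.2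
      have h3 : (l.length : WithBot ℕ∞) ≤
          ringKrullDim (MvPolynomial (Fin s) k ⧸ l.head.1.asIdeal) :=
        l.length_le_ringKrullDim_quotient le_rfl
      rw [← hc] at h2
      have h4 := add_le_add (WithBot.coe_le_coe.2 h2) h3
      rw [h1] at h4
      exact_mod_cast h4
    rw [← hc]
    have h5 : (⨆ l : LTSeries (PrimeSpectrum.zeroLocus (J : Set (MvPolynomial (Fin s) k))),
        (l.length : WithBot ℕ∞)) ≤ ((s - c : ℕ) : WithBot ℕ∞) := by
      refine iSup_le fun l ↦ ?_
      have := key l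
      exact_mod_cast (by omega : l.length ≤ s - c)
    refine (add_le_add_right h5 _).trans ?_
    have h6 := key (Classical.arbitrary _)
    have h7 : c + (s - c) = s := by omega
    refine le_of_eq ?_
    conv_rhs => rw [← h7]
    push_cast
    rfl
  · obtain ⟨P, hP, hJP, hh⟩ := Ideal.exists_isPrime_height_eq hc.symm
    rw [← hc, ← MvPolynomial.height_add_ringKrullDim_quotient_of_isPrime s P, hh]
    exact add_le_add le_rfl (ringKrullDim_le_of_surjective (Ideal.Quotient.factor hJP)
      (Ideal.Quotient.factor_surjective hJP))

theorem idealHeight_eq {A : Type*} [CommRing A] (I : Ideal A) : idealHeight I = I.height := by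
  rw [idealHeight, Ideal.height_eq_inf_minimalPrimes]
  refine le_antisymm (le_iInf₂ fun P hP ↦ ?_) (le_iInf₂ fun P hP ↦ ?_)
  · have : P.IsPrime := hP.1.1
    refine (iInf₂_le (⟨P, hP.1.1⟩ : PrimeSpectrum A) hP.1.2).trans ?_
    exact (PrimeSpectrum.height_eq_orderHeight ⟨P, hP.1.1⟩).ge
  · obtain ⟨Q, hQ, hQP⟩ := Ideal.exists_minimalPrimes_le hP
    refine (iInf₂_le Q hQ).trans ((Ideal.height_mono hQP).trans ?_)
    exact (PrimeSpectrum.height_eq_orderHeight P).le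

section HomogeneousIdeals

variable {k : Type} [Field k] {σ : Type}

theorem homogeneousComponent_add_mul {e : ℕ} {a : MvPolynomial σ k} (ha : a.IsHomogeneous e)
    (t : ℕ) (g : MvPolynomial σ k) :
    homogeneousComponent (e + t) (a * g) = a * homogeneousComponent t g := by
  let := MvPolynomial.gradedAlgebra (σ := σ) (R := k)
  have h := DirectSum.coe_decompose_mul_add_of_left_mem (homogeneousSubmodule σ k) (j := t) (b := g)
    ((mem_homogeneousSubmodule e a).2 ha)
  have h1 : ∀ (p : MvPolynomial σ k) (i : ℕ),
      (DirectSum.decompose (homogeneousSubmodule σ k) p i : MvPolynomial σ k) =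
        homogeneousComponent i p := fun p i ↦ decomposition.decompose'_apply p i
  rwa [h1, h1] at h

theorem homogeneousComponent_mul_eq_zero_of_lt {e : ℕ} {a : MvPolynomial σ k}
    (ha : a.IsHomogeneous e) {i : ℕ} (hi : i < e) (g : MvPolynomial σ k) :
    homogeneousComponent i (a * g) = 0 := by
  let := MvPolynomial.gradedAlgebra (σ := σ) (R := k)
  have h := DirectSum.coe_decompose_mul_of_left_mem_of_not_le (homogeneousSubmodule σ k) (b := g)
    ((mem_homogeneousSubmodule e a).2 ha) hi.not_ge
  have h1 : ∀ (p : MvPolynomial σ k) (i : ℕ),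
      (DirectSum.decompose (homogeneousSubmodule σ k) p i : MvPolynomial σ k) =
        homogeneousComponent i p := fun p i ↦ decomposition.decompose'_apply p i
  rwa [h1] at h

/-- The colon ideal `L : a`. -/
noncomputable def colonIdeal (L : Ideal (MvPolynomial σ k)) (a : MvPolynomial σ k) :
    Ideal (MvPolynomial σ k) :=
  Submodule.comap (LinearMap.mulLeft (MvPolynomial σ k) a) L

@[simp]
theorem mem_colonIdeal {L : Ideal (MvPolynomial σ k)} {a g : MvPolynomial σ k} :
    g ∈ colonIdeal L a ↔ a * g ∈ L := Iff.rfl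

theorem IsHomogeneousIdeal.colon {L : Ideal (MvPolynomial σ k)} (hL : IsHomogeneousIdeal L)
    {e : ℕ} {a : MvPolynomial σ k} (ha : a.IsHomogeneous e) :
    IsHomogeneousIdeal (colonIdeal L a) := by
  intro p hp i
  rw [mem_colonIdeal] at hp ⊢
  rw [← homogeneousComponent_add_mul ha]
  exact hL _ hp _

theorem isHomogeneousIdeal_top : IsHomogeneousIdeal (⊤ : Ideal (MvPolynomial σ k)) :=
  fun _ _ _ ↦ trivial

theorem IsHomogeneousIdeal.span_mul_add {K L : Ideal (MvPolynomial σ k)}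
    (hK : IsHomogeneousIdeal K) (hL : IsHomogeneousIdeal L) {e : ℕ} {a : MvPolynomial σ k}
    (ha : a.IsHomogeneous e) : IsHomogeneousIdeal (Ideal.span {a} * K + L) := by
  intro p hp i
  obtain ⟨q, hq, h, hh, rfl⟩ := Submodule.mem_sup.1 hp
  obtain ⟨g, hg, rfl⟩ := Ideal.mem_span_singleton_mul.1 hq
  rw [map_add]
  refine Ideal.add_mem _ (Submodule.mem_sup_left ?_) (Submodule.mem_sup_right (hL _ hh _))
  by_cases hi : i < e
  · rw [homogeneousComponent_mul_eq_zero_of_lt ha hi]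
    exact Ideal.zero_mem _
  · obtain ⟨t, rfl⟩ := Nat.exists_eq_add_of_le (not_lt.1 hi)
    rw [homogeneousComponent_add_mul ha]
    exact Ideal.mul_mem_mul (Ideal.mem_span_singleton_self a) (hK _ hg _)

/-- The degree `t` piece of an ideal. -/
noncomputable def idealPiece (I : Ideal (MvPolynomial σ k)) (t : ℕ) :
    Submodule k (MvPolynomial σ k) :=
  Submodule.restrictScalars k I ⊓ homogeneousSubmodule σ k t

theorem mem_idealPiece {I : Ideal (MvPolynomial σ k)} {t : ℕ} {p : MvPolynomial σ k} :
    p ∈ idealPiece I t ↔ p ∈ I ∧ p.IsHomogeneous t := Iff.rfl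

instance [Finite σ] (t : ℕ) : FiniteDimensional k (homogeneousSubmodule σ k t) :=
  Module.Finite.iff_fg.2 (homogeneousSubmodule_fg σ k t)

instance [Finite σ] (I : Ideal (MvPolynomial σ k)) (t : ℕ) :
    FiniteDimensional k (idealPiece I t) :=
  Submodule.finiteDimensional_of_le inf_le_right

theorem finrank_idealPiece_span_mul_add [Finite σ] {K L : Ideal (MvPolynomial σ k)}
    (hK : IsHomogeneousIdeal K) (hL : IsHomogeneousIdeal L) {e : ℕ} {a : MvPolynomial σ k}
    (ha : a.IsHomogeneous e) (ha0 : a ≠ 0) (t : ℕ) :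
    Module.finrank k (idealPiece (Ideal.span {a} * K + L) (e + t)) +
        Module.finrank k (idealPiece (K ⊓ colonIdeal L a) t) =
      Module.finrank k (idealPiece K t) + Module.finrank k (idealPiece L (e + t)) := by
  let φ := LinearMap.mulLeft k a
  have hφ : Function.Injective φ := fun x y h ↦ mul_left_cancel₀ ha0 h
  have hmap : ∀ V : Submodule k (MvPolynomial σ k),
      Module.finrank k (V.map φ) = Module.finrank k V :=
    fun V ↦ (Submodule.equivMapOfInjective φ hφ V).finrank_eq.symm
  have h1 : idealPiece (Ideal.span {a} * K + L) (e + t) =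
      (idealPiece K t).map φ ⊔ idealPiece L (e + t) := by
    refine le_antisymm ?_ (sup_le ?_ ?_)
    · rintro p ⟨hp, hpt⟩
      obtain ⟨q, hq, h, hh, rfl⟩ := Submodule.mem_sup.1 hp
      obtain ⟨g, hg, rfl⟩ := Ideal.mem_span_singleton_mul.1 hq
      rw [← homogeneousComponent_eq_self hpt, map_add, homogeneousComponent_add_mul ha]
      exact Submodule.add_mem_sup
        (Submodule.mem_map_of_mem (f := φ) ⟨hK _ hg _, homogeneousComponent_mem _ _⟩)
        ⟨hL _ hh _, homogeneousComponent_mem _ _⟩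
    · rintro _ ⟨g, ⟨hg, hgt⟩, rfl⟩
      exact ⟨Submodule.mem_sup_left (Ideal.mul_mem_mul (Ideal.mem_span_singleton_self a) hg),
        ha.mul hgt⟩
    · exact inf_le_inf_right _ fun x hx ↦ Submodule.mem_sup_right hx
  have h2 : (idealPiece (K ⊓ colonIdeal L a) t).map φ =
      (idealPiece K t).map φ ⊓ idealPiece L (e + t) := by
    ext p
    constructor
    · rintro ⟨g, ⟨⟨hgK, hgL⟩, hgt⟩, rfl⟩
      exact ⟨⟨g, ⟨hgK, hgt⟩, rfl⟩, hgL, ha.mul hgt⟩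
    · rintro ⟨⟨g, ⟨hgK, hgt⟩, rfl⟩, hgL, -⟩
      exact ⟨g, ⟨⟨hgK, hgL⟩, hgt⟩, rfl⟩
  rw [h1, ← hmap (idealPiece (K ⊓ colonIdeal L a) t), h2,
    Submodule.finrank_sup_add_finrank_inf_eq, hmap]

/-- The Hilbert function of `R/I` on natural numbers. -/
noncomputable def hilbertNat (I : Ideal (MvPolynomial σ k)) (t : ℕ) : ℤ :=
  Module.finrank k (homogeneousSubmodule σ k t) - Module.finrank k (idealPiece I t)

theorem hilbertFn_eq_hilbertNat (I : Ideal (MvPolynomial σ k)) {t : ℤ} (ht : 0 ≤ t) :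
    hilbertFn k I t = hilbertNat I t.toNat := if_neg ht.not_gt

theorem idealPiece_top (t : ℕ) :
    idealPiece (⊤ : Ideal (MvPolynomial σ k)) t = homogeneousSubmodule σ k t := by
  ext p
  simp [mem_idealPiece]

theorem hilbertNat_top (t : ℕ) : hilbertNat (⊤ : Ideal (MvPolynomial σ k)) t = 0 := by
  rw [hilbertNat, idealPiece_top, sub_self]

theorem hilbertNat_add [Finite σ] {L : Ideal (MvPolynomial σ k)}
    (hL : IsHomogeneousIdeal L) {e : ℕ} {a : MvPolynomial σ k}
    (ha : a.IsHomogeneous e) (ha0 : a ≠ 0) (t : ℕ) :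
    hilbertNat L (e + t) =
      hilbertNat (Ideal.span {a} * ⊤ + L) (e + t) + hilbertNat (colonIdeal L a) t := by
  have := finrank_idealPiece_span_mul_add isHomogeneousIdeal_top hL ha ha0 t
  rw [top_inf_eq, idealPiece_top] at this
  simp only [hilbertNat]
  omega

theorem hilbertNat_span_mul_add [Finite σ] {K L : Ideal (MvPolynomial σ k)} (hLK : L ≤ K)
    (hK : IsHomogeneousIdeal K) (hL : IsHomogeneousIdeal L) {e : ℕ} {a : MvPolynomial σ k}
    (ha : a.IsHomogeneous e) (ha0 : a ≠ 0) (hnzd : ∀ g, a * g ∈ L → g ∈ L) (t : ℕ) :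
    hilbertNat (Ideal.span {a} * K + L) (e + t) =
      hilbertNat K t + hilbertNat L (e + t) - hilbertNat L t := by
  have := finrank_idealPiece_span_mul_add hK hL ha ha0 t
  have h : K ⊓ colonIdeal L a = L := le_antisymm (fun g hg ↦ hnzd g hg.2)
    (le_inf hLK fun g hg ↦ Ideal.mul_mem_left _ a hg)
  rw [h] at this
  simp only [hilbertNat]
  omega

theorem mem_irrelevantIdeal {p : MvPolynomial σ k} :
    p ∈ irrelevantIdeal k σ ↔ constantCoeff p = 0 := by
  have h : irrelevantIdeal k σ = idealOfVars σ k := rfl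
  have := mem_pow_idealOfVars_iff' (σ := σ) (R := k) 1 p
  rw [pow_one, ← h] at this
  rw [this]
  constructor
  · intro h
    exact h 0 (by simp)
  · intro h x hx
    obtain rfl : x = 0 := (Finsupp.degree_eq_zero_iff x).1 (by omega)
    exact h

theorem irrelevantIdeal_isMaximal : (irrelevantIdeal k σ).IsMaximal := by
  have h : irrelevantIdeal k σ = RingHom.ker (constantCoeff (σ := σ) (R := k)) := by
    ext p
    rw [mem_irrelevantIdeal, RingHom.mem_ker]
  rw [h]
  exact RingHom.ker_isMaximal_of_surjective _ fun x ↦ ⟨C x, by simp⟩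

theorem IsHomogeneousIdeal.le_irrelevantIdeal {I : Ideal (MvPolynomial σ k)}
    (hI : IsHomogeneousIdeal I) (hI' : I ≠ ⊤) : I ≤ irrelevantIdeal k σ := by
  intro p hp
  rw [mem_irrelevantIdeal]
  by_contra h
  have h0 := hI p hp 0
  rw [homogeneousComponent_zero] at h0
  exact hI' (Ideal.eq_top_of_isUnit_mem _ h0 ((isUnit_iff_ne_zero.2 h).map C))

theorem IsHomogeneousIdeal.isPrime_or_exists {I : Ideal (MvPolynomial σ k)}
    (hI : IsHomogeneousIdeal I) (hI' : I ≠ ⊤) : I.IsPrime ∨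
    ∃ (e : ℕ) (a b : MvPolynomial σ k), a.IsHomogeneous e ∧ a ∉ I ∧ b ∉ I ∧ a * b ∈ I := by
  let := MvPolynomial.gradedAlgebra (σ := σ) (R := k)
  by_contra! h
  refine h.1 (Ideal.IsHomogeneous.isPrime_of_homogeneous_mem_or_mem
    (𝒜 := homogeneousSubmodule σ k) ?_ hI' ?_)
  · intro i p hp
    have h1 : (DirectSum.decompose (homogeneousSubmodule σ k) p i : MvPolynomial σ k) =
        homogeneousComponent i p := decomposition.decompose'_apply p i
    rw [h1]
    exact hI p hp i
  · rintro a b ⟨e, ha⟩ - hab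
    by_contra! h'
    exact h.2 e a b ha h'.1 h'.2 hab

end HomogeneousIdeals

section DifferencePolynomials

open Polynomial

theorem coeff_taylor_sub_self {P : ℚ[X]} {r : ℕ} (hP : P.natDegree = r + 1) (d : ℚ) :
    (taylor d P - P).coeff r = d * (r + 1) * P.leadingCoeff := by
  have h1 : (hasseDeriv r P).natDegree ≤ 1 :=
    (natDegree_hasseDeriv_le P r).trans (by omega)
  rw [Polynomial.coeff_sub, taylor_coeff, eq_X_add_C_of_natDegree_le_one h1]
  simp [hasseDeriv_coeff, leadingCoeff, hP, add_comm 1 r]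
  ring

theorem natDegree_taylor_sub_self_le {P : ℚ[X]} {r : ℕ} (hP : P.natDegree = r + 1) (d : ℚ) :
    (taylor d P - P).natDegree ≤ r := by
  rw [natDegree_le_iff_coeff_eq_zero]
  intro N hN
  rw [Polynomial.coeff_sub]
  obtain rfl | h := (Nat.succ_le_of_lt hN).eq_or_lt
  · rw [Nat.succ_eq_add_one, ← hP, coeff_taylor_natDegree, coeff_natDegree, sub_self]
  · rw [coeff_eq_zero_of_natDegree_lt (by rw [natDegree_taylor]; omega),
      coeff_eq_zero_of_natDegree_lt (by omega), sub_self]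

theorem exists_taylor_one_sub_self_eq (Q : ℚ[X]) : ∃ G : ℚ[X], taylor 1 G - G = Q := by
  induction Q using Polynomial.induction_on' with
  | add p q hp hq =>
    obtain ⟨G, rfl⟩ := hp
    obtain ⟨H, rfl⟩ := hq
    exact ⟨G + H, by rw [map_add]; ring⟩
  | monomial n a =>
    refine ⟨Polynomial.C (a / (n + 1)) * Polynomial.bernoulli (n + 1), ?_⟩
    have h := Polynomial.bernoulli_comp_one_add_X (n + 1)
    have hn : (n + 1 : ℚ) ≠ 0 := by positivity
    rw [taylor_apply, mul_comp, Polynomial.C_comp, map_one, add_comm Polynomial.X 1, h,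
      nsmul_eq_mul,
      ← Polynomial.C_mul_X_pow_eq_monomial, mul_add, add_sub_cancel_left, ← mul_assoc]
    congr 1
    rw [← map_natCast (Polynomial.C : ℚ →+* ℚ[X]), ← Polynomial.C_mul]
    congr 1
    push_cast
    field_simp

theorem polynomial_eq_of_eventually_eval_eq {P Q : ℚ[X]}
    (h : ∀ᶠ t : ℕ in Filter.atTop, P.eval (t : ℚ) = Q.eval (t : ℚ)) : P = Q := by
  obtain ⟨N, hN⟩ := Filter.eventually_atTop.1 h
  refine Polynomial.eq_of_infinite_eval_eq P Q ?_
  refine Set.infinite_of_injective_forall_mem (f := fun t : ℕ ↦ ((N + t : ℕ) : ℚ)) ?_ ?_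
  · intro a b hab
    simpa using hab
  · intro t
    exact hN _ (by omega)

theorem degree_add_eq_max_of_leadingCoeff_nonneg {P Q : ℚ[X]} (hP : 0 ≤ P.leadingCoeff)
    (hQ : 0 ≤ Q.leadingCoeff) : (P + Q).degree = max P.degree Q.degree ∧
      0 ≤ (P + Q).leadingCoeff := by
  rcases eq_or_ne P 0 with rfl | hP0
  · simpa using hQ
  rcases eq_or_ne Q 0 with rfl | hQ0
  · simpa using hP
  have h1 := hP.lt_of_ne' (leadingCoeff_ne_zero.2 hP0)
  have h2 := hQ.lt_of_ne' (leadingCoeff_ne_zero.2 hQ0)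
  refine ⟨degree_add_eq_of_leadingCoeff_add_ne_zero (by positivity), ?_⟩
  rcases lt_trichotomy P.degree Q.degree with h | h | h
  · rw [leadingCoeff_add_of_degree_lt h]; exact hQ
  · rw [leadingCoeff_add_of_degree_eq h (by positivity)]; positivity
  · rw [leadingCoeff_add_of_degree_lt' h]; exact hP

/-- If the difference `P(t+1) - P(t)` of a nonzero polynomial with nonnegative value in the
constant case is `Q`, then `deg P = deg Q + 1`. -/
theorem degree_of_taylor_one_sub_self {P Q : ℚ[X]} (h : taylor 1 P - P = Q)
    (hQ : 0 ≤ Q.leadingCoeff) (hP0 : P ≠ 0) (hP : P.natDegree = 0 → 0 ≤ P.leadingCoeff) :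
    0 ≤ P.leadingCoeff ∧
      ∀ r : ℕ, ((r + 1 : ℕ) : WithBot ℕ) ≤ P.degree ↔ (r : WithBot ℕ) ≤ Q.degree := by
  rcases hN : P.natDegree with _ | N
  · refine ⟨hP hN, fun r ↦ ?_⟩
    have hQ0 : Q = 0 := by
      rw [← h, eq_C_of_natDegree_eq_zero hN, taylor_C, sub_self]
    rw [hQ0, degree_eq_natDegree hP0, hN]
    simp
    exact_mod_cast Nat.succ_pos r
  · have h1 := coeff_taylor_sub_self hN 1
    have h2 := natDegree_taylor_sub_self_le hN 1
    rw [h] at h1 h2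
    have hlc := leadingCoeff_ne_zero.2 hP0
    have h3 : Q.coeff N ≠ 0 := by rw [h1]; positivity
    have h4 : Q.natDegree = N := natDegree_eq_of_le_of_coeff_ne_zero h2 h3
    have hQ0 : Q ≠ 0 := by rintro rfl; simp at h3
    constructor
    · rw [leadingCoeff, h4, h1] at hQ
      by_contra! h5
      have : (1 : ℚ) * (N + 1) * P.leadingCoeff < 0 := mul_neg_of_pos_of_neg (by positivity) h5
      linarith
    · intro r
      rw [degree_eq_natDegree hP0, degree_eq_natDegree hQ0, hN, h4]
      norm_cast
      omega

end DifferencePolynomials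

section HilbertPolynomial

variable {k : Type} [Field k]

theorem ringKrullDim_quotient_eq_max_colonIdeal {σ : Type} (I : Ideal (MvPolynomial σ k))
    (a : MvPolynomial σ k) :
    ringKrullDim (MvPolynomial σ k ⧸ I) =
      max (ringKrullDim (MvPolynomial σ k ⧸ (Ideal.span {a} * ⊤ + I)))
        (ringKrullDim (MvPolynomial σ k ⧸ colonIdeal I a)) := by
  refine le_antisymm ?_ (max_le ?_ ?_)
  · rw [ringKrullDim_quotient I]
    refine iSup_le fun l ↦ le_max_iff.2 ?_
    by_cases ha : a ∈ l.head.1.asIdeal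
    · refine Or.inl (l.length_le_ringKrullDim_quotient (sup_le ?_ l.head.2))
      rw [Ideal.mul_top, Ideal.span_singleton_le_iff_mem]
      exact ha
    · refine Or.inr (l.length_le_ringKrullDim_quotient fun g hg ↦ ?_)
      exact (l.head.1.isPrime.mem_or_mem (l.head.2 hg)).resolve_left ha
  · exact ringKrullDim_le_of_surjective (Ideal.Quotient.factor le_sup_right)
      (Ideal.Quotient.factor_surjective _)
  · have h : I ≤ colonIdeal I a := fun g hg ↦ Ideal.mul_mem_left _ a hg
    exact ringKrullDim_le_of_surjective (Ideal.Quotient.factor h)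
      (Ideal.Quotient.factor_surjective _)

/-- A polynomial which eventually computes the Hilbert function of `R/I`, has nonnegative leading
coefficient, and has degree `dim R/I - 1`. -/
structure IsHilbertPolynomial {σ : Type} (I : Ideal (MvPolynomial σ k)) (P : Polynomial ℚ) :
    Prop where
  eventually_eq : ∀ᶠ t : ℕ in Filter.atTop, (hilbertNat I t : ℚ) = P.eval (t : ℚ)
  leadingCoeff_nonneg : 0 ≤ P.leadingCoeff
  lt_ringKrullDim_iff (r : ℕ) :
    (r : WithBot ℕ∞) < ringKrullDim (MvPolynomial σ k ⧸ I) ↔ (r : WithBot ℕ) ≤ P.degree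

theorem isHilbertPolynomial_top {σ : Type} :
    IsHilbertPolynomial (⊤ : Ideal (MvPolynomial σ k)) 0 := by
  refine ⟨.of_forall fun t ↦ by simp [hilbertNat_top], by simp, fun r ↦ ?_⟩
  have : Subsingleton (MvPolynomial σ k ⧸ (⊤ : Ideal (MvPolynomial σ k))) :=
    Ideal.Quotient.subsingleton_iff.2 rfl
  rw [ringKrullDim_eq_bot_of_subsingleton]
  simp

theorem eventually_add_left {p : ℕ → Prop} (e : ℕ) :
    (∀ᶠ t in Filter.atTop, p t) ↔ ∀ᶠ t in Filter.atTop, p (e + t) := by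
  simp only [Filter.eventually_atTop]
  constructor
  · rintro ⟨N, hN⟩
    exact ⟨N, fun t ht ↦ hN _ (by omega)⟩
  · rintro ⟨N, hN⟩
    refine ⟨e + N, fun t ht ↦ ?_⟩
    obtain ⟨s, rfl⟩ := Nat.exists_eq_add_of_le (show e ≤ t by omega)
    exact hN _ (by omega)

theorem IsHilbertPolynomial.of_colonIdeal {σ : Type} [Finite σ] {I : Ideal (MvPolynomial σ k)}
    (hI : IsHomogeneousIdeal I) {e : ℕ} {a : MvPolynomial σ k} (ha : a.IsHomogeneous e)
    (ha0 : a ≠ 0) {P Q : Polynomial ℚ} (hP : IsHilbertPolynomial (Ideal.span {a} * ⊤ + I) P)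
    (hQ : IsHilbertPolynomial (colonIdeal I a) Q) :
    IsHilbertPolynomial I (P + Polynomial.taylor (-e : ℚ) Q) := by
  have hQ' : 0 ≤ (Polynomial.taylor (-e : ℚ) Q).leadingCoeff := by
    rw [Polynomial.leadingCoeff_taylor]; exact hQ.leadingCoeff_nonneg
  have hdeg := degree_add_eq_max_of_leadingCoeff_nonneg hP.leadingCoeff_nonneg hQ'
  refine ⟨?_, hdeg.2, fun r ↦ ?_⟩
  · rw [eventually_add_left e]
    filter_upwards [(eventually_add_left e).1 hP.eventually_eq, hQ.eventually_eq] with t h1 h2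
    rw [hilbertNat_add hI ha ha0, Polynomial.eval_add, Polynomial.taylor_eval]
    push_cast at h1 ⊢
    rw [h1, h2]
    simp
  · rw [hdeg.1, ringKrullDim_quotient_eq_max_colonIdeal I a, lt_max_iff, le_max_iff,
      Polynomial.degree_taylor, hP.lt_ringKrullDim_iff, hQ.lt_ringKrullDim_iff]

theorem isHilbertPolynomial_irrelevantIdeal {σ : Type} :
    IsHilbertPolynomial (irrelevantIdeal k σ) 0 := by
  refine ⟨?_, by simp, fun r ↦ ?_⟩
  · filter_upwards [Filter.eventually_ge_atTop 1] with t ht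
    have : idealPiece (irrelevantIdeal k σ) t = homogeneousSubmodule σ k t := by
      refine le_antisymm inf_le_right fun p hp ↦ ⟨?_, hp⟩
      refine mem_irrelevantIdeal.2 ?_
      rw [constantCoeff_eq]
      exact IsHomogeneous.coeff_eq_zero hp (by simp; omega)
    rw [hilbertNat, this]
    simp
  · have := irrelevantIdeal_isMaximal (k := k) (σ := σ)
    rw [ringKrullDim_eq_zero_of_isField
      ((Ideal.Quotient.maximal_ideal_iff_isField_quotient _).1 this)]
    simp only [Polynomial.degree_zero, le_bot_iff, WithBot.natCast_ne_bot, iff_false, not_lt]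
    exact_mod_cast Nat.zero_le r

theorem hilbertNat_pos {σ : Type} [Finite σ] {I : Ideal (MvPolynomial σ k)} {t : ℕ}
    {p : MvPolynomial σ k} (hp : p.IsHomogeneous t) (hpI : p ∉ I) : 0 < hilbertNat I t := by
  have h : idealPiece I t < homogeneousSubmodule σ k t :=
    lt_of_le_of_ne inf_le_right fun h ↦ hpI ((h ▸ hp : p ∈ idealPiece I t).1)
  have := Submodule.finrank_lt_finrank_of_lt h
  rw [hilbertNat]
  omega

theorem ringKrullDim_quotient_span_add_one {σ : Type} [Finite σ] {I : Ideal (MvPolynomial σ k)}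
    [hI : I.IsPrime] (hle : I ≤ irrelevantIdeal k σ) {x : MvPolynomial σ k}
    (hx : x ∈ irrelevantIdeal k σ) (hxI : x ∉ I) :
    ringKrullDim (MvPolynomial σ k ⧸ (Ideal.span {x} * ⊤ + I)) + 1 =
      ringKrullDim (MvPolynomial σ k ⧸ I) := by
  have hm := irrelevantIdeal_isMaximal (k := k) (σ := σ)
  let M := (irrelevantIdeal k σ).map (Ideal.Quotient.mk I)
  have hM : M.IsMaximal := by
    refine Ideal.IsMaximal.map_of_surjective_of_ker_le Ideal.Quotient.mk_surjective ?_
    rwa [Ideal.mk_ker]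
  have := Module.ringKrullDim_quotient_add_one_of_mem_nonZeroDivisors
    (r := Ideal.Quotient.mk I x) (p := M)
    (mem_nonZeroDivisors_of_ne_zero (by rwa [Ne, Ideal.Quotient.eq_zero_iff_mem]))
    (Ideal.IsMaximal.height_eq_ringKrullDim_of_finiteType (k := k) M)
    (Ideal.mem_map_of_mem _ hx)
  rw [← this]
  congr 1
  have h : Ideal.span {Ideal.Quotient.mk I x} = (Ideal.span {x}).map (Ideal.Quotient.mk I) := by
    rw [Ideal.map_span, Set.image_singleton]
  rw [h]
  refine (ringKrullDim_eq_of_ringEquiv (Ideal.quotEquivOfEq ?_)).trans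
    (ringKrullDim_eq_of_ringEquiv (DoubleQuot.quotQuotEquivQuotSup I (Ideal.span {x}))).symm
  rw [Ideal.mul_top, Submodule.add_eq_sup, sup_comm]

theorem natCast_succ_lt_add_one_iff (r : ℕ) (d : WithBot ℕ∞) :
    ((r + 1 : ℕ) : WithBot ℕ∞) < d + 1 ↔ (r : WithBot ℕ∞) < d := by
  induction d with
  | bot => simp
  | coe d =>
    induction d with
    | top =>
      refine iff_of_true ?_ ?_
      · exact WithBot.coe_lt_coe.2 (ENat.natCast_lt_top _)
      · exact WithBot.coe_lt_coe.2 (ENat.natCast_lt_top _)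
    | coe d =>
      norm_cast
      omega

theorem exists_isHilbertPolynomial_of_isPrime {σ : Type} [Finite σ]
    {I : Ideal (MvPolynomial σ k)} [hI : I.IsPrime] (hom : IsHomogeneousIdeal I) {i : σ}
    (hi : (X i : MvPolynomial σ k) ∉ I) {Q : Polynomial ℚ}
    (hQ : IsHilbertPolynomial (Ideal.span {(X i : MvPolynomial σ k)} * ⊤ + I) Q) :
    ∃ P, IsHilbertPolynomial I P := by
  have hle := hom.le_irrelevantIdeal hI.ne_top
  have hXm : (X i : MvPolynomial σ k) ∈ irrelevantIdeal k σ :=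
    mem_irrelevantIdeal.2 (constantCoeff_X _ i)
  have hcolon : colonIdeal I (X i) = I := le_antisymm
    (fun g hg ↦ (hI.mem_or_mem hg).resolve_left hi) fun g hg ↦ Ideal.mul_mem_left _ _ hg
  have hdim := ringKrullDim_quotient_span_add_one hle hXm hi
  obtain ⟨G, hG⟩ := exists_taylor_one_sub_self_eq (Polynomial.taylor 1 Q)
  have hstep : ∀ᶠ t : ℕ in Filter.atTop, (hilbertNat I (1 + t) : ℚ) - G.eval ((1 + t : ℕ) : ℚ) =
      hilbertNat I t - G.eval (t : ℚ) := by
    filter_upwards [(eventually_add_left 1).1 hQ.eventually_eq] with t ht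
    have h1 := hilbertNat_add hom (isHomogeneous_X k i) (X_ne_zero i) t
    have h2 := congrArg (Polynomial.eval (t : ℚ)) hG
    rw [Polynomial.eval_sub, Polynomial.taylor_eval, Polynomial.taylor_eval] at h2
    rw [h1, hcolon]
    push_cast at ht ⊢
    rw [ht, add_comm (1 : ℚ)]
    linarith
  obtain ⟨N, hN⟩ := Filter.eventually_atTop.1 hstep
  let c : ℚ := hilbertNat I N - G.eval (N : ℚ)
  let P := G + Polynomial.C c
  have hev : ∀ t, N ≤ t → (hilbertNat I t : ℚ) = P.eval (t : ℚ) := by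
    intro t ht
    induction t, ht using Nat.le_induction with
    | base => simp [P, c]
    | succ t ht ih =>
      have := hN t ht
      rw [add_comm 1 t] at this
      simp only [P, Polynomial.eval_add, Polynomial.eval_C] at ih ⊢
      linarith
  have hpos : ∀ t, N ≤ t → 0 < P.eval (t : ℚ) := by
    intro t ht
    rw [← hev t ht]
    have h1 : ((X i : MvPolynomial σ k) ^ t).IsHomogeneous t := by
      simpa using (isHomogeneous_X k i).pow t
    exact_mod_cast hilbertNat_pos h1 fun h ↦ hi (hI.mem_of_pow_mem t h)
  have hP0 : P ≠ 0 := by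
    intro h
    simpa [h] using hpos N le_rfl
  have hPd : Polynomial.taylor 1 P - P = Polynomial.taylor 1 Q := by
    rw [← hG]
    simp [P]
  have key := degree_of_taylor_one_sub_self hPd
    (by rw [Polynomial.leadingCoeff_taylor]; exact hQ.leadingCoeff_nonneg) hP0 (fun h ↦ by
      have h1 := hpos N le_rfl
      rw [Polynomial.eq_C_of_natDegree_eq_zero h] at h1 ⊢
      simpa using h1.le)
  refine ⟨P, Filter.eventually_atTop.2 ⟨N, hev⟩, key.1, fun r ↦ ?_⟩
  rw [← hdim]
  rcases r with _ | r
  · have h1 : (0 : WithBot ℕ) ≤ P.degree := by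
      rw [Polynomial.degree_eq_natDegree hP0]; exact_mod_cast Nat.zero_le _
    refine iff_of_true ?_ h1
    have : Nontrivial (MvPolynomial σ k ⧸ (Ideal.span {(X i : MvPolynomial σ k)} * ⊤ + I)) := by
      refine Ideal.Quotient.nontrivial_iff.2 fun h ↦
        (irrelevantIdeal_isMaximal (k := k) (σ := σ)).ne_top (top_le_iff.1 (h ▸ sup_le ?_ hle))
      rwa [Ideal.mul_top, Ideal.span_singleton_le_iff_mem]
    have h2 := ringKrullDim_nonneg_of_nontrivial
      (R := MvPolynomial σ k ⧸ (Ideal.span {(X i : MvPolynomial σ k)} * ⊤ + I))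
    exact lt_of_lt_of_le (by simp) (add_le_add_left h2 1)
  · rw [key.2, Polynomial.degree_taylor, ← hQ.lt_ringKrullDim_iff]
    exact natCast_succ_lt_add_one_iff r _

theorem IsHomogeneousIdeal.exists_isHilbertPolynomial {σ : Type} [Finite σ]
    {I : Ideal (MvPolynomial σ k)} (hI : IsHomogeneousIdeal I) :
    ∃ P, IsHilbertPolynomial I P := by
  induction I using IsNoetherian.induction with
  | _ I ih =>
  rcases eq_or_ne I ⊤ with rfl | hI'
  · exact ⟨0, isHilbertPolynomial_top⟩
  have hsup : ∀ (e : ℕ) (a : MvPolynomial σ k), a.IsHomogeneous e → a ∉ I →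
      ∃ P, IsHilbertPolynomial (Ideal.span {a} * ⊤ + I) P := by
    intro e a ha haI
    refine ih _ (lt_of_le_of_ne le_sup_right fun h ↦ haI ?_)
      (isHomogeneousIdeal_top.span_mul_add hI ha)
    rw [h]
    rw [Ideal.mul_top]
    exact Submodule.mem_sup_left (Ideal.mem_span_singleton_self a)
  rcases hI.isPrime_or_exists hI' with hp | ⟨e, a, b, ha, haI, hbI, hab⟩
  · by_cases h : ∃ i : σ, (X i : MvPolynomial σ k) ∉ I
    · obtain ⟨i, hi⟩ := h
      obtain ⟨Q, hQ⟩ := hsup 1 _ (isHomogeneous_X k i) hi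
      exact exists_isHilbertPolynomial_of_isPrime hI hi hQ
    · push Not at h
      have : I = irrelevantIdeal k σ := le_antisymm (hI.le_irrelevantIdeal hI') (by
        rw [irrelevantIdeal, Ideal.span_le]
        rintro _ ⟨i, rfl⟩
        exact h i)
      exact ⟨0, this ▸ isHilbertPolynomial_irrelevantIdeal⟩
  · obtain ⟨P, hP⟩ := hsup e a ha haI
    obtain ⟨Q, hQ⟩ := ih (colonIdeal I a) (lt_of_le_of_ne
      (fun g hg ↦ Ideal.mul_mem_left _ a hg) fun h ↦ hbI (h ▸ hab)) (hI.colon ha)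
    exact ⟨_, .of_colonIdeal hI ha (fun h ↦ haI (h ▸ I.zero_mem)) hP hQ⟩

end HilbertPolynomial

section Multiplicity

variable {k : Type} [Field k] {σ : Type}

theorem hilbertPoly_eq_of_eventually {I : Ideal (MvPolynomial σ k)} {P : Polynomial ℚ}
    (hP : ∀ᶠ t : ℕ in Filter.atTop, (hilbertNat I t : ℚ) = P.eval (t : ℚ)) :
    hilbertPoly k I = P := by
  have h : ∃ P : Polynomial ℚ, IsHilbertPolyOf k I P := by
    obtain ⟨N, hN⟩ := Filter.eventually_atTop.1 hP
    refine ⟨P, N, fun t ht ↦ ?_⟩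
    have ht0 : 0 ≤ t := by omega
    rw [hilbertFn_eq_hilbertNat I ht0, hN t.toNat (by omega)]
    congr 1
    exact_mod_cast Int.toNat_of_nonneg ht0
  rw [hilbertPoly, dif_pos h]
  obtain ⟨N, hN⟩ := h.choose_spec
  refine polynomial_eq_of_eventually_eval_eq ?_
  filter_upwards [hP, Filter.eventually_ge_atTop N.toNat] with t h1 h2
  have h3 := hN t (by omega)
  rw [hilbertFn_eq_hilbertNat I (by omega), Int.toNat_natCast, h1] at h3
  exact_mod_cast h3.symm

theorem IsHilbertPolynomial.degree_eq {I : Ideal (MvPolynomial σ k)} {P : Polynomial ℚ}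
    (hP : IsHilbertPolynomial I P) {δ : ℕ}
    (hδ : ringKrullDim (MvPolynomial σ k ⧸ I) = ((δ + 1 : ℕ) : WithBot ℕ∞)) :
    P.natDegree = δ ∧ 0 < P.leadingCoeff := by
  have h1 := (hP.lt_ringKrullDim_iff δ).1 (by rw [hδ]; exact_mod_cast Nat.lt_succ_self δ)
  have h2 : ¬ _ := mt (hP.lt_ringKrullDim_iff (δ + 1)).2 (by rw [hδ]; exact lt_irrefl _)
  have hP0 : P ≠ 0 := by
    rintro rfl
    simp at h1
  rw [Polynomial.degree_eq_natDegree hP0] at h1 h2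
  norm_cast at h1 h2
  exact ⟨by omega, hP.leadingCoeff_nonneg.lt_of_ne' (Polynomial.leadingCoeff_ne_zero.2 hP0)⟩

theorem multiplicityDeg_span_mul_add [Finite σ] {K L : Ideal (MvPolynomial σ k)} (hLK : L ≤ K)
    (hK : IsHomogeneousIdeal K) (hL : IsHomogeneousIdeal L) {d : ℕ} {a : MvPolynomial σ k}
    (ha : a.IsHomogeneous d) (ha0 : a ≠ 0) (hnzd : ∀ g, a * g ∈ L → g ∈ L) {δ : ℕ}
    (hdK : ringKrullDim (MvPolynomial σ k ⧸ K) = ((δ + 1 : ℕ) : WithBot ℕ∞))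
    (hdL : ringKrullDim (MvPolynomial σ k ⧸ L) = ((δ + 1 + 1 : ℕ) : WithBot ℕ∞)) :
    multiplicityDeg k (Ideal.span {a} * K + L) =
      multiplicityDeg k K + (d : ℚ) * multiplicityDeg k L := by
  obtain ⟨P, hP⟩ := hK.exists_isHilbertPolynomial
  obtain ⟨Q, hQ⟩ := hL.exists_isHilbertPolynomial
  obtain ⟨hPd, hPl⟩ := hP.degree_eq hdK
  obtain ⟨hQd, hQl⟩ := hQ.degree_eq hdL
  let S := P + (Polynomial.taylor (d : ℚ) Q - Q)
  have hS : hilbertPoly k (Ideal.span {a} * K + L) = Polynomial.taylor (-d : ℚ) S := by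
    refine hilbertPoly_eq_of_eventually ?_
    rw [eventually_add_left d]
    filter_upwards [hP.eventually_eq, hQ.eventually_eq,
      (eventually_add_left d).1 hQ.eventually_eq] with t h1 h2 h3
    rw [hilbertNat_span_mul_add hLK hK hL ha ha0 hnzd]
    push_cast at h3 ⊢
    rw [h1, h2, h3, Polynomial.taylor_eval]
    simp [S, Polynomial.taylor_eval, add_comm (d : ℚ)]
    ring
  have hc : S.coeff δ = P.leadingCoeff + d * (δ + 1) * Q.leadingCoeff := by
    rw [Polynomial.coeff_add, coeff_taylor_sub_self hQd, ← hPd, Polynomial.coeff_natDegree]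
  have hSd : S.natDegree = δ := by
    refine Polynomial.natDegree_eq_of_le_of_coeff_ne_zero
      (Polynomial.natDegree_add_le_of_degree_le hPd.le (natDegree_taylor_sub_self_le hQd _)) ?_
    rw [hc]
    positivity
  rw [multiplicityDeg, multiplicityDeg, multiplicityDeg, hS, Polynomial.natDegree_taylor,
    Polynomial.leadingCoeff_taylor, hilbertPoly_eq_of_eventually hP.eventually_eq,
    hilbertPoly_eq_of_eventually hQ.eventually_eq, hPd, hQd, hSd,
    Polynomial.leadingCoeff, hSd, hc, Nat.factorial_succ]
  push_cast
  ring

end Multiplicity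

section ExtVanishing

open CategoryTheory.Abelian

/-- In a short exact sequence whose middle term has vanishing `Ext` in degrees `≤ r`, vanishing for
the first term in degrees `≤ r` is equivalent to vanishing for the last term in degrees `< r`. -/
theorem CategoryTheory.ShortComplex.ShortExact.subsingleton_ext_iff {C : Type*} [Category C]
    [Abelian C] [HasExt C] {S : ShortComplex C} (hS : S.ShortExact) (X : C) (r : ℕ)
    (h₂ : ∀ i < r + 1, Subsingleton (Ext X S.X₂ i)) :
    (∀ i < r + 1, Subsingleton (Ext X S.X₁ i)) ↔ ∀ i < r, Subsingleton (Ext X S.X₃ i) := by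
  constructor
  · intro h i hi
    have := h (i + 1) (by lia)
    have := h₂ i (by lia)
    refine subsingleton_of_forall_eq 0 fun x => ?_
    obtain ⟨y, rfl⟩ := Ext.covariant_sequence_exact₃ X hS x rfl (Subsingleton.elim _ _)
    rw [Subsingleton.elim y 0, Ext.zero_comp]
  · intro h i hi
    have := h₂ i hi
    cases i with
    | zero =>
      have := hS.mono_f
      exact (Ext.postcomp_mk₀_injective_of_mono X S.f).subsingleton
    | succ i =>
      have := h i (by lia)
      refine subsingleton_of_forall_eq 0 fun x => ?_
      obtain ⟨y, rfl⟩ := Ext.covariant_sequence_exact₁ X hS x (Subsingleton.elim _ _) rfl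
      rw [Subsingleton.elim y 0, Ext.zero_comp]

universe u

theorem ModuleCat.subsingleton_ext_iff_of_exact {R : Type u} [CommRing R]
    {L M N : Type u} [AddCommGroup L] [AddCommGroup M] [AddCommGroup N] [Module R L] [Module R M]
    [Module R N] {a : L →ₗ[R] M} {b : M →ₗ[R] N} (ha : Function.Injective a)
    (hb : Function.Surjective b) (hab : Function.Exact a b) (X : ModuleCat.{u} R) (r : ℕ)
    (h₂ : ∀ i < r + 1, Subsingleton (Ext X (ModuleCat.of R M) i)) :
    (∀ i < r + 1, Subsingleton (Ext X (ModuleCat.of R L) i)) ↔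
      ∀ i < r, Subsingleton (Ext X (ModuleCat.of R N) i) := by
  let S : ShortComplex (ModuleCat.{u} R) := ShortComplex.mk (ModuleCat.ofHom a) (ModuleCat.ofHom b)
    (by ext x; exact hab.apply_apply_eq_zero x)
  have hS : S.ShortExact :=
    { exact := (ShortComplex.ShortExact.moduleCat_exact_iff_function_exact S).2 hab
      mono_f := (ModuleCat.mono_iff_injective _).2 ha
      epi_g := (ModuleCat.epi_iff_surjective _).2 hb }
  exact hS.subsingleton_ext_iff X r h₂

/-- The ideal `K / L` of `R / L` embeds into `R / L` with cokernel `R / K`, and also, through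
multiplication by a nonzerodivisor `a`, with cokernel `R / (a K + L)`. -/
theorem Ideal.subsingleton_ext_quotient_span_mul_add_iff {R : Type u} [CommRing R] {K L : Ideal R}
    (hLK : L ≤ K) {a : R} (ha : ∀ g, a * g ∈ L → g ∈ L) (X : ModuleCat.{u} R) (r : ℕ)
    (hL : ∀ i < r + 1, Subsingleton (Ext X (ModuleCat.of R (R ⧸ L)) i)) :
    (∀ i < r, Subsingleton (Ext X (ModuleCat.of R (R ⧸ (Ideal.span {a} * K + L))) i)) ↔
      ∀ i < r, Subsingleton (Ext X (ModuleCat.of R (R ⧸ K)) i) := by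
  let J : Submodule R (R ⧸ L) := Submodule.map (Submodule.mkQ L) K
  have hLI : L ≤ Ideal.span {a} * K + L := le_sup_right
  rw [← ModuleCat.subsingleton_ext_iff_of_exact (L := J) (a := J.subtype)
      (b := Submodule.factor hLK) J.injective_subtype (Submodule.factor_surjective hLK) ?_ X r hL,
    ← ModuleCat.subsingleton_ext_iff_of_exact (L := J) (a := a • J.subtype)
      (b := Submodule.factor hLI) ?_ (Submodule.factor_surjective hLI) ?_ X r hL]
  · rw [injective_iff_map_eq_zero]
    rintro ⟨x, hx⟩ h
    obtain ⟨x, rfl⟩ := Submodule.mkQ_surjective L x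
    simp only [Subtype.ext_iff, Submodule.coe_zero, Submodule.mkQ_apply]
    refine (Submodule.Quotient.mk_eq_zero _).2 (ha x ?_)
    exact (Submodule.Quotient.mk_eq_zero L).1 h
  · intro y
    obtain ⟨y, rfl⟩ := Submodule.mkQ_surjective L y
    rw [Submodule.factor_mk, Submodule.mkQ_apply, Submodule.Quotient.mk_eq_zero]
    constructor
    · intro h
      obtain ⟨u, hu, v, hv, rfl⟩ := Submodule.mem_sup.1 h
      obtain ⟨z, hz, rfl⟩ := Ideal.mem_span_singleton_mul.1 hu
      refine ⟨⟨Submodule.mkQ L z, Submodule.mem_map_of_mem hz⟩, ?_⟩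
      refine (Submodule.Quotient.eq L).2 ?_
      simpa using hv
    · rintro ⟨⟨_, z, hz, rfl⟩, h⟩
      have h' : a * z - y ∈ L := (Submodule.Quotient.eq L).1 h
      rw [← sub_sub_cancel (a * z) y]
      exact sub_mem (Submodule.mem_sup_left
        (Ideal.mul_mem_mul (Ideal.mem_span_singleton_self a) hz)) (Submodule.mem_sup_right h')
  · intro y
    obtain ⟨y, rfl⟩ := Submodule.mkQ_surjective L y
    rw [Submodule.factor_mk, Submodule.mkQ_apply, Submodule.Quotient.mk_eq_zero]
    constructor
    · exact fun h => ⟨⟨Submodule.mkQ L y, Submodule.mem_map_of_mem h⟩, rfl⟩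
    · rintro ⟨⟨_, z, hz, rfl⟩, h⟩
      have h' : z - y ∈ L := (Submodule.Quotient.eq L).1 h
      rw [← sub_sub_cancel z y]
      exact sub_mem hz (hLK h')

end ExtVanishing

section Depth

universe u

theorem RingTheory.Sequence.IsRegular.length_le_supportDim {R : Type u} [CommRing R]
    [IsNoetherianRing R] {M : Type u} [AddCommGroup M] [Module R M] [Module.Finite R M]
    {rs : List R} (h : RingTheory.Sequence.IsRegular M rs) :
    (rs.length : WithBot ℕ∞) ≤ Module.supportDim R M := by
  induction rs generalizing M with
  | nil =>
    have hbot := (Module.supportDim_ne_bot_iff_nontrivial R M).2 h.nontrivial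
    rw [← WithBot.coe_unbot _ hbot]
    exact WithBot.coe_le_coe.mpr zero_le
  | cons r rs ih =>
    obtain ⟨hr, hrs⟩ := (RingTheory.Sequence.isRegular_cons_iff M r rs).1 h
    refine le_trans ?_ (Module.supportDim_quotSMulTop_succ_le_of_notMem_minimalPrimes
      fun _ => hr.notMem_of_mem_minimalPrimes)
    rw [List.length_cons]
    push_cast
    gcongr
    exact ih hrs

/-- The depth of `R / I` with respect to an ideal `m ⊇ I` equals its finite dimension `D` if and
only if the modules `Ext i (R / m) (R / I)` vanish for `i < D`. -/
theorem idealDepth_quotient_eq_ringKrullDim_iff {R : Type u} [CommRing R] [IsNoetherianRing R]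
    {I m : Ideal R} (hm : m ≠ ⊤) (hI : I ≤ m) {D : ℕ}
    (hD : ringKrullDim (R ⧸ I) = (D : WithBot ℕ∞)) :
    (idealDepth m (R ⧸ I) : WithBot ℕ∞) = ringKrullDim (R ⧸ I) ↔
      ∀ i < D, Subsingleton (Abelian.Ext (ModuleCat.of R (Shrink.{u} (R ⧸ m)))
        (ModuleCat.of R (R ⧸ I)) i) := by
  have hlt : m • (⊤ : Submodule R (ModuleCat.of R (R ⧸ I))) < ⊤ := by
    refine lt_top_iff_ne_top.2 fun h => hm ((Ideal.eq_top_iff_one m).2 ?_)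
    have hle : m • (⊤ : Submodule R (R ⧸ I)) ≤ Submodule.map (Submodule.mkQ I) m := by
      refine Submodule.smul_le.2 fun r hr x _ => ?_
      obtain ⟨x, rfl⟩ := Submodule.mkQ_surjective I x
      exact ⟨r * x, m.mul_mem_right x hr, rfl⟩
    obtain ⟨y, hy, hy'⟩ := hle (h.symm ▸ Submodule.mem_top : Submodule.mkQ I 1 ∈ _)
    rw [← sub_sub_cancel y 1]
    exact sub_mem hy (hI ((Submodule.Quotient.eq I).1 hy'))
  have hext := (ModuleCat.exists_isRegular_tfae m D (ModuleCat.of R (R ⧸ I)) hlt).out 1 3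
  refine Iff.trans ?_ hext.symm
  rw [hD]
  have hle : ∀ rs : List R, RingTheory.Sequence.IsRegular (R ⧸ I) rs → rs.length ≤ D := by
    intro rs hrs
    have := hrs.length_le_supportDim
    rw [Module.supportDim_quotient_eq_ringKrullDim, hD] at this
    exact_mod_cast this
  have key : (idealDepth m (R ⧸ I) : WithBot ℕ∞) = (D : WithBot ℕ∞) ↔
      idealDepth m (R ⧸ I) = (D : ℕ∞) := by
    norm_cast
  rw [key]
  constructor
  · intro h
    have : Nontrivial (R ⧸ I) := Ideal.Quotient.nontrivial_iff.2 (ne_top_of_le_ne_top hm hI)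
    have : Nonempty {n : ℕ∞ | ∃ rs : List R, (rs.length : ℕ∞) = n ∧ (∀ r ∈ rs, r ∈ m) ∧
        RingTheory.Sequence.IsRegular (R ⧸ I) rs} :=
      ⟨0, [], by simp, by simp, RingTheory.Sequence.IsRegular.nil R (R ⧸ I)⟩
    have hmem := ENat.sSup_mem_of_nonempty_of_lt_top (h.trans_lt (ENat.natCast_lt_top D))
    obtain ⟨rs, hlen, hrs⟩ := hmem
    exact ⟨rs, by exact_mod_cast hlen.trans h, hrs⟩
  · rintro ⟨rs, hlen, hmem, hreg⟩
    refine le_antisymm (sSup_le ?_) (le_sSup ⟨rs, by rw [hlen], hmem, hreg⟩)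
    rintro _ ⟨rs', rfl, -, h'⟩
    exact_mod_cast hle rs' h'

end Depth

section Height

theorem Ideal.height_span_mul_add {R : Type*} [CommRing R] [IsNoetherianRing R] {K L : Ideal R}
    {b : ℕ} (hLK : L ≤ K) {a : R} (ha : ∀ g, a * g ∈ L → g ∈ L) (hK : K.height = (b + 1 : ℕ))
    (hL : L.height = b) : (Ideal.span {a} * K + L).height = (b + 1 : ℕ) := by
  refine le_antisymm (hK ▸ Ideal.height_mono (sup_le Ideal.mul_le_right hLK)) ?_
  rw [Ideal.height_eq_inf_minimalPrimes]
  refine le_iInf₂ fun P hP => ?_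
  have := hP.isPrime
  have hLP : L ≤ P := le_sup_right.trans hP.1.2
  rcases this.mul_le.1 (le_sup_left.trans hP.1.2) with haP | hKP
  · by_contra! hlt
    have hle : P.height ≤ L.height := by
      rw [hL]
      exact Order.lt_add_one_iff_of_not_isMax (by simp) |>.1 (by exact_mod_cast hlt)
    have hmin := Ideal.mem_minimalPrimes_of_height_le hLP hle
    have hreg : IsSMulRegular (R ⧸ L) a := by
      refine IsSMulRegular.of_right_eq_zero_of_smul fun x hx => ?_
      obtain ⟨x, rfl⟩ := Submodule.mkQ_surjective L x
      exact (Submodule.Quotient.mk_eq_zero L).2 (ha x ((Submodule.Quotient.mk_eq_zero L).1 hx))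
    refine hreg.notMem_of_mem_minimalPrimes ?_ (haP (Ideal.mem_span_singleton_self a))
    rwa [Ideal.annihilator_quotient]
  · exact hK ▸ Ideal.height_mono hKP

theorem Ideal.ne_top_of_height_eq_natCast {R : Type*} [CommRing R] (J : Ideal R) {b : ℕ}
    (hJ : J.height = b) : J ≠ ⊤ := by
  rintro rfl
  exact ENat.natCast_ne_top b (hJ.symm.trans Ideal.height_top)

end Height

theorem MvPolynomial.ringKrullDim_quotient_of_height_eq {k : Type} [Field k] {s b r : ℕ}
    {J : Ideal (MvPolynomial (Fin s) k)} (hJ : J.height = b) (hs : s = b + r) :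
    ringKrullDim (MvPolynomial (Fin s) k ⧸ J) = (r : WithBot ℕ∞) := by
  have h := MvPolynomial.height_add_ringKrullDim_quotient s J (J.ne_top_of_height_eq_natCast hJ)
  rw [hJ] at h
  have hne : ringKrullDim (MvPolynomial (Fin s) k ⧸ J) ≠ ⊥ := by
    intro hbot
    simp [hbot] at h
  subst hs
  obtain ⟨x, hx⟩ := WithBot.ne_bot_iff_exists.1 hne
  rw [← hx] at h ⊢
  have h' : (b : ℕ∞) + x = b + r := by exact_mod_cast h
  exact_mod_cast ENat.add_right_injective_of_ne_top (ENat.natCast_ne_top b) h'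

theorem statement2 (k : Type) [Field k] [Infinite k] (n c : ℕ) (hc : 1 ≤ c) (hcn : c ≤ n)
    (I_C I_S : Ideal (MvPolynomial (Fin (n + 1)) k))
    (homC : IsHomogeneousIdeal I_C)
    (satC : Submodule.colon (I_C : Submodule (MvPolynomial (Fin (n + 1)) k)
        (MvPolynomial (Fin (n + 1)) k)) (irrelevantIdeal k (Fin (n + 1))) = I_C)
    (htC : idealHeight I_C = (c : ℕ∞))
    (hSC : I_S ≤ I_C) (homS : IsHomogeneousIdeal I_S)
    (htS : idealHeight I_S = ((c - 1 : ℕ) : ℕ∞))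
    (cmS : IsCMQuotient I_S)
    (f : MvPolynomial (Fin (n + 1)) k) (d : ℕ) (hf : f.IsHomogeneous d)
    (hnzd : ∀ g, f * g ∈ I_S → g ∈ I_S) :
    (IsCMQuotient (Ideal.span {f} * I_C + I_S) ↔ IsCMQuotient I_C) ∧
      multiplicityDeg k (Ideal.span {f} * I_C + I_S)
        = multiplicityDeg k I_C + (d : ℚ) * multiplicityDeg k I_S := by
  obtain ⟨b, rfl⟩ : ∃ b, c = b + 1 := ⟨c - 1, by lia⟩
  obtain ⟨δ, rfl⟩ := Nat.exists_eq_add_of_le hcn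
  rw [idealHeight_eq] at htC htS
  rw [Nat.add_sub_cancel] at htS
  have htI := Ideal.height_span_mul_add hSC hnzd htC htS
  have hdC := MvPolynomial.ringKrullDim_quotient_of_height_eq (r := δ + 1) htC (by lia)
  have hdS := MvPolynomial.ringKrullDim_quotient_of_height_eq (r := δ + 1 + 1) htS (by lia)
  have hdI := MvPolynomial.ringKrullDim_quotient_of_height_eq (r := δ + 1) htI (by lia)
  have hCtop := I_C.ne_top_of_height_eq_natCast htC
  have hm := (irrelevantIdeal_isMaximal (k := k) (σ := Fin (b + 1 + δ + 1))).ne_top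
  have hCm := homC.le_irrelevantIdeal hCtop
  have hIC : Ideal.span {f} * I_C + I_S ≤ I_C := sup_le Ideal.mul_le_right hSC
  have hf0 : f ≠ 0 := by
    rintro rfl
    exact hCtop ((Ideal.eq_top_iff_one _).2 (hSC (hnzd 1 (by simp))))
  refine ⟨?_, multiplicityDeg_span_mul_add hSC homC homS hf hf0 hnzd hdC hdS⟩
  rw [IsCMQuotient, idealDepth_quotient_eq_ringKrullDim_iff hm (hSC.trans hCm) hdS] at cmS
  rw [IsCMQuotient, IsCMQuotient, idealDepth_quotient_eq_ringKrullDim_iff hm hCm hdC,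
    idealDepth_quotient_eq_ringKrullDim_iff hm (hIC.trans hCm) hdI]
  exact Ideal.subsingleton_ext_quotient_span_mul_add_iff hSC hnzd _ _ cmS
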